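/- Let q, t ∈ ℝ with q ≠ 0, t ≠ 0 and 1 − t²q^j ≠ 0 for every integer j ≥ 0. Then for all y, z ∈ ℝ and all integers n ≥ 1 and 0 ≤ k < n: Σ_{m=0}^{n−k} [n−k choose m]_q · p_{n−k−m}(z|y, tq^{m+k}, q) · g_m(z|y, tq^{m+k−1}, q) / [ (t²q^{2m+2k};q)_{n−k−m} · (t²q^{m+2k−1};q)_m ] = 0. -/

import Mathlib

open Finset

section Defs

variable {K : Type*} [Field K]

/-- q-Pochhammer symbol `(a; q)_n = ∏_{j=0}^{n-1} (1 - a q^j)`. -/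
def qPoch (a q : K) (n : ℕ) : K := ∏ j ∈ Finset.range n, (1 - a * q ^ j)

/-- Gaussian (q-binomial) coefficient `[n choose k]_q`. -/
def qBinom (q : K) : ℕ → ℕ → K
  | _, 0 => 1
  | 0, _ + 1 => 0
  | n + 1, k + 1 => qBinom q n k + q ^ (k + 1) * qBinom q n (k + 1)

/-- Continuous q-Hermite polynomials `h_n(x|q)`:
`h_{-1} = 0`, `h_0 = 1`, `h_{n+1} = 2x h_n - (1 - q^n) h_{n-1}`. -/
def hQH (q x : K) : ℕ → K
  | 0 => 1
  | 1 => 2 * x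
  | n + 2 => 2 * x * hQH q x (n + 1) - (1 - q ^ (n + 1)) * hQH q x n

/-- The polynomials `b_n(x|q) = (-1)^n q^{n(n-1)/2} h_n(x|q^{-1})` (for `q ≠ 0`). -/
def bQH (q x : K) (n : ℕ) : K := (-1) ^ n * q ^ (n * (n - 1) / 2) * hQH q⁻¹ x n

/-- Al-Salam–Chihara polynomials in conjugate-pair parametrization `p_n(x|y,ρ,q)`:
`p_{-1} = 0`, `p_0 = 1`,
`p_{n+1} = 2(x - ρ y q^n) p_n - (1 - q^n)(1 - ρ² q^{n-1}) p_{n-1}`. -/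
def pASC (q x y ρ : K) : ℕ → K
  | 0 => 1
  | 1 => 2 * (x - ρ * y)
  | n + 2 => 2 * (x - ρ * y * q ^ (n + 1)) * pASC q x y ρ (n + 1)
      - (1 - q ^ (n + 1)) * (1 - ρ ^ 2 * q ^ n) * pASC q x y ρ n

open Classical in
/-- The polynomials `g_n(x|y,ρ,q)`: `ρ^n p_n(y|x,ρ⁻¹,q)` for `ρ ≠ 0`, `b_n(x|q)` for `ρ = 0`. -/
noncomputable def gASC (q x y ρ : K) (n : ℕ) : K :=
  if ρ = 0 then bQH q x n else ρ ^ n * pASC q y x ρ⁻¹ n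

/-- `ω(u,v|ρ) = (1-ρ²)² - 4uvρ(1+ρ²) + 4ρ²(u²+v²)`. -/
def omegaW (u v ρ : K) : K :=
  (1 - ρ ^ 2) ^ 2 - 4 * u * v * ρ * (1 + ρ ^ 2) + 4 * ρ ^ 2 * (u ^ 2 + v ^ 2)

/-- `v(x|t) = 1 - 2xt + t²`. -/
def vQH (x t : K) : K := 1 - 2 * x * t + t ^ 2

/-- Coefficient `e_n(a,b,c,d,q)` of the Askey–Wilson three-term recurrence. -/
def eAW (a b c d q : K) (n : ℕ) : K :=
  q ^ ((n : ℤ) - 2) /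
      ((1 - a * b * c * d * q ^ (2 * (n : ℤ) - 2)) * (1 - a * b * c * d * q ^ (2 * (n : ℤ)))) *
    ((a + b + c + d) * (q ^ 2 - a * b * c * d * q ^ (n : ℤ) * (1 + q - q ^ ((n : ℤ) + 1))) +
      (a * b * c + a * b * d + a * c * d + b * c * d) *
        (q - q ^ ((n : ℤ) + 2) - q ^ ((n : ℤ) + 1) + a * b * c * d * q ^ (2 * (n : ℤ))))

/-- Coefficient `f_n(a,b,c,d,q)` of the Askey–Wilson three-term recurrence. -/
def fAW (a b c d q : K) (n : ℕ) : K :=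
  (1 - q ^ (n : ℤ)) * (1 - a * b * q ^ ((n : ℤ) - 1)) * (1 - a * c * q ^ ((n : ℤ) - 1)) *
      (1 - a * d * q ^ ((n : ℤ) - 1)) * (1 - b * c * q ^ ((n : ℤ) - 1)) *
      (1 - b * d * q ^ ((n : ℤ) - 1)) * (1 - c * d * q ^ ((n : ℤ) - 1)) *
      (1 - a * b * c * d * q ^ ((n : ℤ) - 2)) /
    (qPoch (a * b * c * d * q ^ (2 * (n : ℤ) - 3)) q 3 *
      (1 - a * b * c * d * q ^ (2 * (n : ℤ) - 2)))

/-- Monic Askey–Wilson polynomials `α_n(x|a,b,c,d,q)`: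
`α_{-1} = 0`, `α_0 = 1`, `α_{n+1} = (2x - e_n) α_n - f_n α_{n-1}`. -/
def alphaAW (a b c d q x : K) : ℕ → K
  | 0 => 1
  | 1 => 2 * x - eAW a b c d q 0
  | n + 2 => (2 * x - eAW a b c d q (n + 1)) * alphaAW a b c d q x (n + 1) -
      fAW a b c d q (n + 1) * alphaAW a b c d q x n

/-- Coefficient of `ψ_n` in the continuous dual Hahn recurrence:
`q^n (b+c+d) + bcd q^{n-1} (1 - q^{n+1} - q^n)`. -/
def ePsi (b c d q : K) (n : ℕ) : K :=
  q ^ (n : ℤ) * (b + c + d) + b * c * d * q ^ ((n : ℤ) - 1) * (1 - q ^ ((n : ℤ) + 1) - q ^ (n : ℤ))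

/-- Coefficient of `ψ_{n-1}` in the continuous dual Hahn recurrence:
`(1-q^n)(1-bcq^{n-1})(1-bdq^{n-1})(1-cdq^{n-1})`. -/
def fPsi (b c d q : K) (n : ℕ) : K :=
  (1 - q ^ (n : ℤ)) * (1 - b * c * q ^ ((n : ℤ) - 1)) * (1 - b * d * q ^ ((n : ℤ) - 1)) *
    (1 - c * d * q ^ ((n : ℤ) - 1))

/-- Continuous dual Hahn polynomials `ψ_n(x|b,c,d,q)`:
`ψ_{-1} = 0`, `ψ_0 = 1`, `ψ_{n+1} = (2x - ePsi_n) ψ_n - fPsi_n ψ_{n-1}`. -/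
def psiCDH (b c d q x : K) : ℕ → K
  | 0 => 1
  | 1 => 2 * x - ePsi b c d q 0
  | n + 2 => (2 * x - ePsi b c d q (n + 1)) * psiCDH b c d q x (n + 1) -
      fPsi b c d q (n + 1) * psiCDH b c d q x n

/-- Al-Salam–Chihara polynomials `Q_n(x|c,d,q)`:
`Q_{-1} = 0`, `Q_0 = 1`, `Q_{n+1} = (2x - q^n(c+d)) Q_n - (1-q^n)(1-cdq^{n-1}) Q_{n-1}`. -/
def qASC (c d q x : K) : ℕ → K
  | 0 => 1
  | 1 => 2 * x - (c + d)
  | n + 2 => (2 * x - q ^ (n + 1) * (c + d)) * qASC c d q x (n + 1) -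
      (1 - q ^ (n + 1)) * (1 - c * d * q ^ n) * qASC c d q x n

/-- Coefficient `ẽ_n` of the conjugate-pair Askey–Wilson recurrence. -/
def eW (y ρ₁ z ρ₂ q : K) (n : ℕ) : K :=
  2 * q ^ ((n : ℤ) - 1) /
      ((1 - ρ₁ ^ 2 * ρ₂ ^ 2 * q ^ (2 * (n : ℤ) - 2)) *
        (1 - ρ₁ ^ 2 * ρ₂ ^ 2 * q ^ (2 * (n : ℤ)))) *
    (q * (ρ₁ * y + ρ₂ * z) *
        (1 - ρ₁ ^ 2 * ρ₂ ^ 2 * q ^ ((n : ℤ) - 2) * (1 + q - q ^ ((n : ℤ) + 1))) +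
      ρ₁ * ρ₂ * (ρ₁ * z + ρ₂ * y) *
        (1 - q ^ ((n : ℤ) + 1) - q ^ (n : ℤ) + ρ₁ ^ 2 * ρ₂ ^ 2 * q ^ (2 * (n : ℤ) - 1)))

/-- Coefficient `f̃_n` of the conjugate-pair Askey–Wilson recurrence. -/
def fW (y ρ₁ z ρ₂ q : K) (n : ℕ) : K :=
  (1 - q ^ (n : ℤ)) * omegaW y z (ρ₁ * ρ₂ * q ^ ((n : ℤ) - 1)) *
      (1 - ρ₁ ^ 2 * q ^ ((n : ℤ) - 1)) * (1 - ρ₂ ^ 2 * q ^ ((n : ℤ) - 1)) *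
      (1 - ρ₁ ^ 2 * ρ₂ ^ 2 * q ^ ((n : ℤ) - 2)) /
    (qPoch (ρ₁ ^ 2 * ρ₂ ^ 2 * q ^ (2 * (n : ℤ) - 3)) q 3 *
      (1 - ρ₁ ^ 2 * ρ₂ ^ 2 * q ^ (2 * (n : ℤ) - 2)))

/-- Conjugate-pair Askey–Wilson polynomials `w_n(x|y,ρ₁,z,ρ₂,q)`:
`w_{-1} = 0`, `w_0 = 1`, `w_{n+1} = (2x - ẽ_n) w_n - f̃_n w_{n-1}`. -/
def wAW (x y ρ₁ z ρ₂ q : K) : ℕ → K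
  | 0 => 1
  | 1 => 2 * x - eW y ρ₁ z ρ₂ q 0
  | n + 2 => (2 * x - eW y ρ₁ z ρ₂ q (n + 1)) * wAW x y ρ₁ z ρ₂ q (n + 1) -
      fW y ρ₁ z ρ₂ q (n + 1) * wAW x y ρ₁ z ρ₂ q n

/-- Chebyshev polynomials of the second kind. -/
def chebU (x : K) : ℕ → K
  | 0 => 1
  | 1 => 2 * x
  | n + 2 => 2 * x * chebU x (n + 1) - chebU x n

/-- The quantity `A_n` from the Askey–Wilson recurrence factorization. -/
def A_AW (a b c d q : K) (n : ℕ) : K :=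
  (1 - a * b * q ^ (n : ℤ)) * (1 - a * c * q ^ (n : ℤ)) * (1 - a * d * q ^ (n : ℤ)) *
      (1 - a * b * c * d * q ^ ((n : ℤ) - 1)) /
    (a * (1 - a * b * c * d * q ^ (2 * (n : ℤ) - 1)) * (1 - a * b * c * d * q ^ (2 * (n : ℤ))))

/-- The quantity `C_n` from the Askey–Wilson recurrence factorization. -/
def C_AW (a b c d q : K) (n : ℕ) : K :=
  a * (1 - q ^ (n : ℤ)) * (1 - b * c * q ^ ((n : ℤ) - 1)) * (1 - b * d * q ^ ((n : ℤ) - 1)) *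
      (1 - c * d * q ^ ((n : ℤ) - 1)) /
    ((1 - a * b * c * d * q ^ (2 * (n : ℤ) - 2)) * (1 - a * b * c * d * q ^ (2 * (n : ℤ) - 1)))

end Defs

section QSeries

variable {K : Type*} [Field K]

theorem qPoch_add (a q : K) (m n : ℕ) :
    qPoch a q (m + n) = qPoch a q m * qPoch (a * q ^ m) q n := by
  simp only [qPoch, Finset.prod_range_add, pow_add, mul_assoc]

theorem qPoch_one (a q : K) : qPoch a q 1 = 1 - a := by simp [qPoch]

theorem qPoch_ne_zero {a q : K} {n : ℕ} (h : ∀ j < n, 1 - a * q ^ j ≠ 0) : qPoch a q n ≠ 0 :=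
  Finset.prod_ne_zero_iff.2 fun j hj => h j (Finset.mem_range.1 hj)

theorem qBinom_zero_right (q : K) (n : ℕ) : qBinom q n 0 = 1 := by
  cases n <;> rfl

theorem qBinom_succ_succ (q : K) (n k : ℕ) :
    qBinom q (n + 1) (k + 1) = qBinom q n k + q ^ (k + 1) * qBinom q n (k + 1) := rfl

theorem qBinom_zero_succ (q : K) (k : ℕ) : qBinom q 0 (k + 1) = 0 := rfl

theorem qBinom_eq_zero_of_lt (q : K) {n k : ℕ} (h : n < k) : qBinom q n k = 0 := by
  induction n generalizing k with
  | zero => obtain ⟨k, rfl⟩ := Nat.exists_eq_succ_of_ne_zero h.ne'; rfl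
  | succ n ih =>
    obtain ⟨k, rfl⟩ := Nat.exists_eq_succ_of_ne_zero (Nat.ne_zero_of_lt h)
    rw [Nat.succ_eq_add_one, qBinom_succ_succ, ih (by omega), ih (by omega)]
    simp

theorem qBinom_succ_right_mul (q : K) (n k : ℕ) :
    (1 - q ^ (k + 1)) * q ^ k * qBinom q n (k + 1) = (q ^ k - q ^ n) * qBinom q n k := by
  induction n generalizing k with
  | zero => cases k <;> simp [qBinom_zero_succ]
  | succ n ih =>
    cases k with
    | zero =>
      have h := ih 0
      simp only [qBinom_succ_succ, qBinom_zero_right] at h ⊢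
      linear_combination q * h
    | succ k =>
      simp only [qBinom_succ_succ]
      linear_combination q ^ (k + 2) * ih (k + 1) + q * ih k

theorem qBinom_succ_left_mul (q : K) (n m : ℕ) :
    (q ^ m - q ^ (n + 1)) * qBinom q (n + 1) m = q ^ m * (1 - q ^ (n + 1)) * qBinom q n m := by
  cases m with
  | zero => simp [qBinom_zero_right]
  | succ k =>
    rw [qBinom_succ_succ]
    linear_combination -q * qBinom_succ_right_mul q n k

end QSeries

section Continuants

variable {K : Type*} [Field K]

/-- The continuant `u_n` of the recurrence `u_{n+1} = A_n u_n - B_n u_{n-1}`, `u_0 = 1`,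
`u_{-1} = 0`. -/
def recContinuant (A B : ℕ → K) : ℕ → K
  | 0 => 1
  | 1 => A 0
  | n + 2 => A (n + 1) * recContinuant A B (n + 1) - B (n + 1) * recContinuant A B n

theorem recContinuant_add_two (A B : ℕ → K) (n : ℕ) :
    recContinuant A B (n + 2) =
      A (n + 1) * recContinuant A B (n + 1) - B (n + 1) * recContinuant A B n := rfl

theorem recContinuant_add_two' (A B : ℕ → K) (n : ℕ) :
    recContinuant A B (n + 2) =
      A 0 * recContinuant (fun i => A (i + 1)) (fun i => B (i + 1)) (n + 1) -
        B 1 * recContinuant (fun i => A (i + 2)) (fun i => B (i + 2)) n := by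
  induction n using Nat.twoStepInduction with
  | zero => simp only [recContinuant]; ring
  | one => simp only [recContinuant]; ring
  | more n ih₁ ih₂ =>
    rw [recContinuant_add_two, ih₁, ih₂, recContinuant_add_two (fun i => A (i + 1)) _ (n + 1),
      recContinuant_add_two (fun i => A (i + 1)) _ n, recContinuant_add_two (fun i => A (i + 2))]
    ring

theorem recContinuant_reverse (m : ℕ) {A B A' B' : ℕ → K}
    (hA : ∀ i j, i + j + 1 = m → A' i = A j)
    (hB : ∀ i j, i + j + 2 = m → B' (i + 1) = B (j + 1)) :
    recContinuant A' B' m = recContinuant A B m := by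
  induction m using Nat.twoStepInduction generalizing A B with
  | zero => rfl
  | one => exact hA 0 0 rfl
  | more m ih₁ ih₂ =>
    rw [recContinuant_add_two, recContinuant_add_two', hA (m + 1) 0 rfl, hB m 0 rfl,
      ih₂ (A := fun i => A (i + 1)) (B := fun i => B (i + 1)),
      ih₁ (A := fun i => A (i + 2)) (B := fun i => B (i + 2))]
    · exact fun i j h => hA i (j + 2) (by omega)
    · exact fun i j h => hB i (j + 2) (by omega)
    · exact fun i j h => hA i (j + 1) (by omega)
    · exact fun i j h => hB i (j + 1) (by omega)

theorem recContinuant_scale (m : ℕ) {A B A' B' s : ℕ → K} (hA : ∀ i < m, A' i = s i * A i)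
    (hB : ∀ i, i + 1 < m → B' (i + 1) = s i * s (i + 1) * B (i + 1)) :
    recContinuant A' B' m = (∏ i ∈ Finset.range m, s i) * recContinuant A B m := by
  induction m using Nat.twoStepInduction with
  | zero => simp [recContinuant]
  | one => simp [recContinuant, hA]
  | more m ih₁ ih₂ =>
    rw [recContinuant_add_two, recContinuant_add_two,
      ih₂ (fun i h => hA i (by omega)) (fun i h => hB i (by omega)),
      ih₁ (fun i h => hA i (by omega)) (fun i h => hB i (by omega)),
      hA (m + 1) (by omega), hB m (by omega), Finset.prod_range_succ _ (m + 1),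
      Finset.prod_range_succ _ m]
    ring

end Continuants

section QuadraticLattice

variable {K : Type*} [Field K]

/-- The nodes `q^{-m} + c q^m` of a `q`-quadratic lattice. -/
def latticeNode (q c : K) (m : ℕ) : K := (q ^ m)⁻¹ + c * q ^ m

/-- Up to a factor depending only on `N`, the weights of the `N`-th divided difference at the
nodes `latticeNode q c 0, …, latticeNode q c N`. -/
def latticeWeight (q c : K) (N m : ℕ) : K :=
  (∏ i ∈ Finset.range m, -q ^ i) * qBinom q N m /
    (qPoch (c * q ^ (2 * m + 1)) q (N - m) * qPoch (c * q ^ m) q m)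

variable {q c : K}

theorem qPoch_mul_pow_succ_ne_zero (hc : ∀ j : ℕ, 1 - c * q ^ (j + 1) ≠ 0) (i n : ℕ) :
    qPoch (c * q ^ (i + 1)) q n ≠ 0 := by
  refine qPoch_ne_zero fun j _ => ?_
  have := hc (i + j)
  rwa [mul_assoc, ← pow_add, add_right_comm]

theorem qPoch_mul_pow_self_ne_zero (hc : ∀ j : ℕ, 1 - c * q ^ (j + 1) ≠ 0) (m : ℕ) :
    qPoch (c * q ^ m) q m ≠ 0 := by
  cases m with
  | zero => simp [qPoch]
  | succ m => exact qPoch_mul_pow_succ_ne_zero hc m _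

theorem latticeWeight_succ_mul (hq : q ≠ 0) (hc : ∀ j : ℕ, 1 - c * q ^ (j + 1) ≠ 0)
    {N m : ℕ} (hm : m ≤ N) :
    latticeWeight q c (N + 1) m * (latticeNode q c (N + 1) - latticeNode q c m) =
      (q ^ (N + 1))⁻¹ * (1 - q ^ (N + 1)) * latticeWeight q c N m := by
  have hD : qPoch (c * q ^ (2 * m + 1)) q (N + 1 - m) =
      qPoch (c * q ^ (2 * m + 1)) q (N - m) * (1 - c * q ^ (N + m + 1)) := by
    rw [show N + 1 - m = N - m + 1 by omega, qPoch_add, qPoch_one, mul_assoc, ← pow_add,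
      show 2 * m + 1 + (N - m) = N + m + 1 by omega]
  have h₁ := qPoch_mul_pow_succ_ne_zero hc (2 * m) (N - m)
  have h₂ := qPoch_mul_pow_self_ne_zero hc m
  have h₃ := hc (N + m)
  have hx : latticeNode q c (N + 1) - latticeNode q c m =
      (q ^ (N + 1))⁻¹ * (q ^ m)⁻¹ * ((q ^ m - q ^ (N + 1)) * (1 - c * q ^ (N + m + 1))) := by
    simp only [latticeNode]
    field_simp
    ring
  have hb := qBinom_succ_left_mul q N m
  rw [hx]
  simp only [latticeWeight, hD]
  field_simp
  linear_combination (∏ i ∈ Finset.range m, -q ^ i) * hb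

theorem sum_latticeWeight_mul_node_sub (hq : q ≠ 0) (hc : ∀ j : ℕ, 1 - c * q ^ (j + 1) ≠ 0)
    (N : ℕ) (f : ℕ → K) :
    ∑ m ∈ Finset.range (N + 2),
        latticeWeight q c (N + 1) m * ((latticeNode q c (N + 1) - latticeNode q c m) * f m) =
      (q ^ (N + 1))⁻¹ * (1 - q ^ (N + 1)) *
        ∑ m ∈ Finset.range (N + 1), latticeWeight q c N m * f m := by
  rw [Finset.sum_range_succ, sub_self, zero_mul, mul_zero, add_zero, Finset.mul_sum]
  refine Finset.sum_congr rfl fun m hm => ?_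
  rw [← mul_assoc, latticeWeight_succ_mul hq hc (Nat.lt_succ_iff.1 (Finset.mem_range.1 hm)),
    mul_assoc]

theorem sum_range_latticeWeight (hc : ∀ j : ℕ, 1 - c * q ^ (j + 1) ≠ 0) (N M : ℕ)
    (hM : M ≤ N + 1) :
    ∑ m ∈ Finset.range (M + 1), latticeWeight q c (N + 1) m =
      (∏ i ∈ Finset.range M, -q ^ (i + 1)) * qBinom q N M /
        qPoch (c * q ^ (M + 1)) q (N + 1) := by
  induction M with
  | zero => simp [latticeWeight, qBinom_zero_right, qPoch]
  | succ M ih =>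
    have h₁ := qPoch_mul_pow_succ_ne_zero hc M (N + 1)
    have h₂ := qPoch_mul_pow_succ_ne_zero hc (M + 1) (N + 1)
    have h₃ := qPoch_mul_pow_succ_ne_zero hc (2 * (M + 1)) (N + 1 - (M + 1))
    have h₄ := qPoch_mul_pow_succ_ne_zero hc M (M + 1)
    have h₅ := hc M
    have h₆ := hc (M + 1 + N)
    have h₇ := hc (2 * M + 1)
    have hl : qPoch (c * q ^ (M + 1)) q (N + 2) =
        (1 - c * q ^ (M + 1)) * qPoch (c * q ^ (M + 1 + 1)) q (N + 1) := by
      rw [show N + 2 = 1 + (N + 1) by omega, qPoch_add, qPoch_one, mul_assoc c, ← pow_add]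
    have hr : qPoch (c * q ^ (M + 1)) q (N + 2) =
        qPoch (c * q ^ (M + 1)) q (N + 1) * (1 - c * q ^ (M + 1 + N + 1)) := by
      rw [show N + 2 = (N + 1) + 1 by omega, qPoch_add, qPoch_one, mul_assoc c, ← pow_add]
      rfl
    have hs : qPoch (c * q ^ (M + 1)) q (N + 2) =
        qPoch (c * q ^ (M + 1)) q (M + 1) * (1 - c * q ^ (2 * M + 1 + 1)) *
          qPoch (c * q ^ (2 * (M + 1) + 1)) q (N + 1 - (M + 1)) := by
      rw [show N + 2 = (M + 1) + (1 + (N + 1 - (M + 1))) by omega, qPoch_add, qPoch_add _ _ 1,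
        qPoch_one, mul_assoc c, mul_assoc c, ← pow_add, ← pow_add,
        show M + 1 + (M + 1) = 2 * M + 1 + 1 by omega,
        show 2 * M + 1 + 1 + 1 = 2 * (M + 1) + 1 by omega, mul_assoc]
    have hP : qPoch (c * q ^ (M + 1)) q (N + 2) ≠ 0 := qPoch_mul_pow_succ_ne_zero hc M _
    have hw : latticeWeight q c (N + 1) (M + 1) =
        (∏ i ∈ Finset.range (M + 1), -q ^ i) * qBinom q (N + 1) (M + 1) *
          (1 - c * q ^ (2 * M + 1 + 1)) / qPoch (c * q ^ (M + 1)) q (N + 2) := by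
      rw [latticeWeight, hs]
      field_simp
    have hL : (1 : K) / qPoch (c * q ^ (M + 1)) q (N + 1) =
        (1 - c * q ^ (M + 1 + N + 1)) / qPoch (c * q ^ (M + 1)) q (N + 2) := by
      rw [hr]; field_simp
    have hR : (1 : K) / qPoch (c * q ^ (M + 1 + 1)) q (N + 1) =
        (1 - c * q ^ (M + 1)) / qPoch (c * q ^ (M + 1)) q (N + 2) := by
      rw [hl]; field_simp
    have hprod : ∏ i ∈ Finset.range (M + 1), -q ^ i = -∏ i ∈ Finset.range M, -q ^ (i + 1) := by
      rw [Finset.prod_range_succ']; simp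
    rw [Finset.sum_range_succ, ih (by omega), hw, div_eq_mul_one_div, hL,
      div_eq_mul_one_div (_ * qBinom q N (M + 1)), hR, hprod, Finset.prod_range_succ _ M,
      qBinom_succ_succ]
    field_simp
    linear_combination
      (-c * q ^ (M + 2)) * (∏ i ∈ Finset.range M, -q ^ (i + 1)) * qBinom_succ_right_mul q N M

theorem sum_latticeWeight (hc : ∀ j : ℕ, 1 - c * q ^ (j + 1) ≠ 0) {N : ℕ} (hN : 1 ≤ N) :
    ∑ m ∈ Finset.range (N + 1), latticeWeight q c N m = 0 := by
  obtain ⟨N, rfl⟩ := Nat.exists_eq_add_of_le' hN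
  rw [sum_range_latticeWeight hc N (N + 1) le_rfl, qBinom_eq_zero_of_lt q N.lt_succ_self]
  simp

/-- The off-diagonal coefficients of the recurrence below are affine in the node. -/
theorem one_sub_mul_one_sub_eq (hq : q ≠ 0) (m n : ℕ) :
    1 + c * q ^ (2 * n) - q ^ n * latticeNode q c m =
      (1 - q ^ n * (q ^ m)⁻¹) * (1 - c * q ^ (n + m)) := by
  simp only [latticeNode]
  field_simp
  ring

theorem sum_latticeWeight_mul_recContinuant (hq : q ≠ 0)
    (hc : ∀ j : ℕ, 1 - c * q ^ (j + 1) ≠ 0) (A B₀ B₁ : ℕ → K) (j : ℕ) {N : ℕ} (hN : 1 ≤ N)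
    (hj : j ≤ N) :
    ∑ m ∈ Finset.range (N + 1), latticeWeight q c N m *
      recContinuant A (fun i => B₀ i - B₁ i * latticeNode q c m) j = 0 := by
  induction j using Nat.twoStepInduction generalizing N with
  | zero => simpa [recContinuant] using sum_latticeWeight hc hN
  | one => simp [recContinuant, ← Finset.sum_mul, sum_latticeWeight hc hN]
  | more j ih₁ ih₂ =>
    obtain ⟨N, rfl⟩ := Nat.exists_eq_add_of_le' hN
    have h₁ := ih₁ hN (by omega)
    have h₂ := ih₂ hN (by omega)
    have h₃ := sum_latticeWeight_mul_node_sub hq hc N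
      (fun m => recContinuant A (fun i => B₀ i - B₁ i * latticeNode q c m) j)
    rw [ih₁ (N := N) (by omega) (by omega), mul_zero] at h₃
    calc
      _ = A (j + 1) * ∑ m ∈ Finset.range (N + 1 + 1), latticeWeight q c (N + 1) m *
            recContinuant A (fun i => B₀ i - B₁ i * latticeNode q c m) (j + 1) -
          (B₀ (j + 1) - B₁ (j + 1) * latticeNode q c (N + 1)) *
            ∑ m ∈ Finset.range (N + 1 + 1), latticeWeight q c (N + 1) m *
              recContinuant A (fun i => B₀ i - B₁ i * latticeNode q c m) j -
          B₁ (j + 1) * ∑ m ∈ Finset.range (N + 2), latticeWeight q c (N + 1) m *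
            ((latticeNode q c (N + 1) - latticeNode q c m) *
              recContinuant A (fun i => B₀ i - B₁ i * latticeNode q c m) j) := by
        simp only [Finset.mul_sum, ← Finset.sum_sub_distrib]
        refine Finset.sum_congr rfl fun m _ => ?_
        rw [recContinuant_add_two]
        ring
      _ = 0 := by rw [h₁, h₂, h₃]; ring

end QuadraticLattice

section AlSalamChihara

variable {K : Type*} [Field K] {q ρ c : K}

/-- The common recurrence satisfied, in the degree, by the products
`p_{N-m}(x|y,ρq^m,q) g_m(x|y,ρq^{m-1},q)`. -/
def latticeASC (q c x y ρ : K) (m : ℕ) : ℕ → K :=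
  recContinuant (fun i => 2 * (x - ρ * y * q ^ i))
    (fun i => 1 + c * q ^ (2 * i) - q ^ i * latticeNode q c m)

theorem latticeASC_add (hq : q ≠ 0) (hc : c * q = ρ ^ 2) (x y : K) (m j : ℕ) :
    latticeASC q c x y ρ m (m + j) =
      pASC q x y (ρ * q ^ m) j * latticeASC q c x y ρ m m := by
  induction j using Nat.twoStepInduction with
  | zero => simp [pASC]
  | one =>
    cases m with
    | zero => simp [latticeASC, recContinuant, pASC]
    | succ m =>
      simp only [latticeASC, recContinuant_add_two, pASC]
      rw [one_sub_mul_one_sub_eq hq, mul_inv_cancel₀ (pow_ne_zero _ hq)]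
      ring
  | more j ih₁ ih₂ =>
    have h : latticeASC q c x y ρ m (m + (j + 2)) =
        2 * (x - ρ * y * q ^ (m + (j + 1))) * latticeASC q c x y ρ m (m + (j + 1)) -
          (1 + c * q ^ (2 * (m + (j + 1))) - q ^ (m + (j + 1)) * latticeNode q c m) *
            latticeASC q c x y ρ m (m + j) := rfl
    have hB : 1 + c * q ^ (2 * (m + (j + 1))) - q ^ (m + (j + 1)) * latticeNode q c m =
        (1 - q ^ (j + 1)) * (1 - (ρ * q ^ m) ^ 2 * q ^ j) := by
      rw [one_sub_mul_one_sub_eq hq, pow_add q m, mul_comm (q ^ m),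
        mul_inv_cancel_right₀ (pow_ne_zero _ hq), mul_pow, ← hc]
      ring
    rw [h, ih₁, ih₂, hB]
    simp only [pASC]
    ring

theorem gASC_eq_recContinuant (hρ : ρ ≠ 0) (x y : K) (n : ℕ) :
    gASC q x y ρ n = recContinuant (fun i => 2 * (ρ * y - x * q ^ i))
      (fun i => (1 - q ^ i) * (ρ ^ 2 - q ^ (i - 1))) n := by
  simp only [gASC, if_neg hρ]
  induction n using Nat.twoStepInduction with
  | zero => simp [pASC, recContinuant]
  | one => simp only [pASC, recContinuant]; field_simp
  | more n ih₁ ih₂ =>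
    rw [recContinuant_add_two, ← ih₁, ← ih₂]
    simp only [pASC, Nat.add_sub_cancel]
    field_simp
    ring

theorem gASC_eq_prod_mul_latticeASC (hq : q ≠ 0) (hρ : ρ ≠ 0) (hc : c * q = ρ ^ 2) (x y : K)
    (m : ℕ) :
    gASC q x y (ρ * q ^ ((m : ℤ) - 1)) m =
      (∏ i ∈ Finset.range m, -q ^ i) * latticeASC q c x y ρ m m := by
  rw [gASC_eq_recContinuant (mul_ne_zero hρ (zpow_ne_zero _ hq)), latticeASC,
    ← recContinuant_reverse m (A := fun i => 2 * (x - ρ * y * q ^ i))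
      (B := fun i => 1 + c * q ^ (2 * i) - q ^ i * latticeNode q c m)
      (A' := fun i => 2 * (x - ρ * y * q ^ (m - 1 - i)))
      (B' := fun i => (1 - q ^ (m - i) * (q ^ m)⁻¹) * (1 - c * q ^ (m - i + m)))]
  · refine recContinuant_scale m (fun i hi => ?_) (fun i hi => ?_)
    · obtain ⟨l, rfl⟩ := Nat.exists_eq_add_of_lt hi
      have hz : q ^ (((i + l + 1 : ℕ) : ℤ) - 1) = q ^ i * q ^ l := by
        rw [← pow_add, ← zpow_natCast]; congr 1; push_cast; ring
      rw [hz, show i + l + 1 - 1 - i = l by omega]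
      ring
    · obtain ⟨l, rfl⟩ := Nat.exists_eq_add_of_lt hi
      have hz : q ^ (((i + 1 + l + 1 : ℕ) : ℤ) - 1) = q ^ i * q * q ^ l := by
        rw [← pow_succ, ← pow_add, ← zpow_natCast]; congr 1; push_cast; ring
      rw [hz, show i + 1 + l + 1 - (i + 1) = l + 1 by omega, Nat.add_sub_cancel, mul_pow, ← hc]
      field_simp
      ring
  · intro i j h
    rw [show m - 1 - i = j by omega]
  · intro i j h
    rw [show m - (i + 1) = j + 1 by omega, one_sub_mul_one_sub_eq hq]

end AlSalamChihara

/-- Corollary (identity ii): a vanishing convolution of `p` and `g` polynomials. -/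
theorem pASC_gASC_identity_ii (q t : ℝ) (hq : q ≠ 0) (ht : t ≠ 0)
    (h : ∀ j : ℕ, 1 - t ^ 2 * q ^ j ≠ 0) (y z : ℝ) (n k : ℕ) (hn : 1 ≤ n) (hk : k < n) :
    ∑ m ∈ Finset.range (n - k + 1),
        qBinom q (n - k) m * pASC q z y (t * q ^ (m + k)) (n - k - m) *
          gASC q z y (t * q ^ ((m : ℤ) + (k : ℤ) - 1)) m /
          (qPoch (t ^ 2 * q ^ (2 * m + 2 * k)) q (n - k - m) *
            qPoch (t ^ 2 * q ^ ((m : ℤ) + 2 * (k : ℤ) - 1)) q m) = 0 := by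
  set N := n - k
  set c : ℝ := t ^ 2 * q ^ (2 * (k : ℤ) - 1) with hcdef
  have hcq : ∀ j : ℕ, c * q ^ (j + 1) = t ^ 2 * q ^ (2 * k + j) := fun j => by
    rw [hcdef, mul_assoc, ← zpow_natCast q, ← zpow_natCast q, ← zpow_add₀ hq]
    congr 2; push_cast; ring
  have hc : ∀ j : ℕ, 1 - c * q ^ (j + 1) ≠ 0 := fun j => by rw [hcq]; exact h _
  have hcρ : c * q = (t * q ^ k) ^ 2 := by
    have := hcq 0
    rw [zero_add, pow_one] at this
    rw [this]
    ring
  have hρ : t * q ^ k ≠ 0 := mul_ne_zero ht (pow_ne_zero _ hq)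
  rw [← sum_latticeWeight_mul_recContinuant hq hc (fun i => 2 * (z - t * q ^ k * y * q ^ i))
    (fun i => 1 + c * q ^ (2 * i)) (fun i => q ^ i) N (by omega : 1 ≤ N) le_rfl]
  refine Finset.sum_congr rfl fun m hm => ?_
  have hF := latticeASC_add hq hcρ z y m (N - m)
  rw [Nat.add_sub_cancel' (Nat.lt_succ_iff.1 (Finset.mem_range.1 hm))] at hF
  have hp : t * q ^ (m + k) = t * q ^ k * q ^ m := by ring
  have hg : t * q ^ ((m : ℤ) + (k : ℤ) - 1) = t * q ^ k * q ^ ((m : ℤ) - 1) := by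
    rw [mul_assoc, ← zpow_natCast q k, ← zpow_add₀ hq]
    congr 2; ring
  have hd₁ : t ^ 2 * q ^ (2 * m + 2 * k) = c * q ^ (2 * m + 1) := by
    rw [hcq, add_comm]
  have hd₂ : t ^ 2 * q ^ ((m : ℤ) + 2 * (k : ℤ) - 1) = c * q ^ m := by
    rw [hcdef, mul_assoc, ← zpow_natCast q m, ← zpow_add₀ hq]
    congr 2; ring
  rw [hp, hg, hd₁, hd₂, gASC_eq_prod_mul_latticeASC hq hρ hcρ]
  change _ = latticeWeight q c N m * latticeASC q c z y (t * q ^ k) m N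
  rw [hF, latticeWeight]
  ring
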